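/- Let D = ⟨Q, μ0, L, δ⟩ be a labelled MDP, let n ≥ 0 and k ≥ 1, and suppose B ∈ ℝ^{Q×k} is a matrix such that for all subdistributions μ_D, μ_E over Q: μ_D ∼_n μ_E if and only if μ_D·B = μ_E·B. Then for all subdistributions μ_D, μ_E over Q: μ_D ∼_{n+1} μ_E if and only if μ_D·B = μ_E·B and μ_D·Δ_{α̂}(a)·B = μ_E·Δ_{α̂}(a)·B holds for all a ∈ L and all local strategies α̂ that are extremal with respect to B. -/

import Mathlib

open Matrix

/-- A labelled Markov decision process (data part): an initial distribution,
a finite nonempty set of available moves at each state, and for each move a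
probability distribution on `L × Q`. -/
structure PreMDP (Q L M : Type*) where
  init : Q → ℝ
  moves : Q → Finset M
  prob : M → L → Q → ℝ

/-- The well-formedness conditions making a `PreMDP` a labelled MDP. -/
def IsMDP {Q L M : Type*} [Fintype Q] [Fintype L] (D : PreMDP Q L M) : Prop :=
  (∀ q, 0 ≤ D.init q) ∧ (∑ q, D.init q = 1) ∧
  (∀ q, (D.moves q).Nonempty) ∧
  (∀ m a q', 0 ≤ D.prob m a q') ∧
  (∀ q, ∀ m ∈ D.moves q, ∑ a : L, ∑ q' : Q, D.prob m a q' = 1)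

/-- A path `q0 a1 q1 ⋯ an qn`: the initial state together with the list of
(label, state) steps. -/
abbrev MPath (Q L : Type*) := Q × List (L × Q)

/-- The last state of a path. -/
def MPath.last {Q L : Type*} (ρ : MPath Q L) : Q :=
  (ρ.2.getLast?).elim ρ.1 Prod.snd

/-- The trace of a path. -/
def MPath.trace {Q L : Type*} (ρ : MPath Q L) : List L := ρ.2.map Prod.fst

/-- A strategy: to each path a probability distribution on the moves available
at its last state. -/
def IsStrategy {Q L M : Type*} (D : PreMDP Q L M) (α : MPath Q L → M → ℝ) : Prop :=
  ∀ ρ : MPath Q L, (∀ m, 0 ≤ α ρ m) ∧ (∀ m, m ∉ D.moves (MPath.last ρ) → α ρ m = 0) ∧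
    (∑ m ∈ D.moves (MPath.last ρ), α ρ m = 1)

/-- A strategy is trace-based if it depends only on the trace and the last
state of the path. -/
def TraceBased {Q L M : Type*} (α : MPath Q L → M → ℝ) : Prop :=
  ∀ ρ ρ' : MPath Q L, MPath.trace ρ = MPath.trace ρ' → MPath.last ρ = MPath.last ρ' → α ρ = α ρ'

/-- Probability of performing the given further steps, starting from the path `ρ`. -/
def probFrom {Q L M : Type*} (D : PreMDP Q L M) (α : MPath Q L → M → ℝ) :
    MPath Q L → List (L × Q) → ℝ
  | _, [] => 1
  | ρ, (a, q) :: rest =>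
      (∑ m ∈ D.moves (MPath.last ρ), α ρ m * D.prob m a q) *
        probFrom D α (ρ.1, ρ.2 ++ [(a, q)]) rest

/-- The probability `Pr_{D,α}(ρ)` of a path. -/
def pathProb {Q L M : Type*} (D : PreMDP Q L M) (α : MPath Q L → M → ℝ) (ρ : MPath Q L) : ℝ :=
  D.init ρ.1 * probFrom D α (ρ.1, []) ρ.2

/-- `subDis D α w q` : the total probability of paths with trace `w` ending in `q`. -/
def subDis {Q L M : Type*} [Fintype Q] [DecidableEq Q] (D : PreMDP Q L M)
    (α : MPath Q L → M → ℝ) (w : List L) (q : Q) : ℝ :=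
  ∑ q0 : Q, ∑ f : Fin w.length → Q,
    if MPath.last ((q0, List.ofFn fun i => (w.get i, f i)) : MPath Q L) = q then
      pathProb D α (q0, List.ofFn fun i => (w.get i, f i)) else 0

/-- The trace-probability function `Tr_{D,α}`. -/
def Tr {Q L M : Type*} [Fintype Q] [DecidableEq Q] (D : PreMDP Q L M)
    (α : MPath Q L → M → ℝ) (w : List L) : ℝ :=
  ∑ q : Q, subDis D α w q

/-- A local strategy: to each state a probability distribution on the moves
available there. -/
def IsLocal {Q L M : Type*} (D : PreMDP Q L M) (β : Q → M → ℝ) : Prop :=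
  ∀ q, (∀ m, 0 ≤ β q m) ∧ (∀ m, m ∉ D.moves q → β q m = 0) ∧ (∑ m ∈ D.moves q, β q m = 1)

/-- The transition matrix `Δ_β(a)` of a local strategy `β` and label `a`. -/
def transMat {Q L M : Type*} (D : PreMDP Q L M) (β : Q → M → ℝ) (a : L) : Matrix Q Q ℝ :=
  Matrix.of fun q q' => ∑ m ∈ D.moves q, β q m * D.prob m a q'

/-- `Succ(μ, β, a) = μ · Δ_β(a)`. -/
def Succ {Q L M : Type*} [Fintype Q] (D : PreMDP Q L M) (μ : Q → ℝ) (β : Q → M → ℝ)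
    (a : L) : Q → ℝ :=
  Matrix.vecMul μ (transMat D β a)

/-- Subdistributions over `Q` (viewed as row vectors). -/
def IsSubDist {Q : Type*} [Fintype Q] (μ : Q → ℝ) : Prop :=
  (∀ q, 0 ≤ μ q) ∧ (∑ q, μ q) ≤ 1

/-- A bisimulation between (sub)distributions of two MDPs. -/
def IsBisim {Q Q' L M M' : Type*} [Fintype Q] [Fintype Q'] (D : PreMDP Q L M)
    (E : PreMDP Q' L M') (R : (Q → ℝ) → (Q' → ℝ) → Prop) : Prop :=
  ∀ μ ν, R μ ν →
    ((∑ q, μ q) = (∑ q, ν q)) ∧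
    (∀ β, IsLocal D β → ∃ γ, IsLocal E γ ∧ ∀ a, R (Succ D μ β a) (Succ E ν γ a)) ∧
    (∀ γ, IsLocal E γ → ∃ β, IsLocal D β ∧ ∀ a, R (Succ D μ β a) (Succ E ν γ a))

/-- `μ ∼ ν`: the largest bisimulation (union of all bisimulations). -/
def Bisim {Q Q' L M M' : Type*} [Fintype Q] [Fintype Q'] (D : PreMDP Q L M)
    (E : PreMDP Q' L M') (μ : Q → ℝ) (ν : Q' → ℝ) : Prop :=
  ∃ R, IsBisim D E R ∧ R μ ν

/-- The approximants `∼ₙ` of the bisimulation relation. -/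
def simN {Q L M : Type*} [Fintype Q] (D : PreMDP Q L M) : ℕ → (Q → ℝ) → (Q → ℝ) → Prop
  | 0 => fun μ ν => (∑ q, μ q) = (∑ q, ν q)
  | n + 1 => fun μ ν =>
      ((∑ q, μ q) = (∑ q, ν q)) ∧
      (∀ β, IsLocal D β → ∃ γ, IsLocal D γ ∧ ∀ a, simN D n (Succ D μ β a) (Succ D ν γ a)) ∧
      (∀ γ, IsLocal D γ → ∃ β, IsLocal D β ∧ ∀ a, simN D n (Succ D μ β a) (Succ D ν γ a))

/-- The point `p(μ, β) ∈ ℝ^{L × k}`: the concatenation of the row vectors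
`μ · Δ_β(a) · B` for `a ∈ L`. -/
def point {Q L M : Type*} {k : ℕ} [Fintype Q] (D : PreMDP Q L M) (B : Matrix Q (Fin k) ℝ)
    (μ : Q → ℝ) (β : Q → M → ℝ) : L × Fin k → ℝ :=
  fun x => Matrix.vecMul (Matrix.vecMul μ (transMat D β x.1)) B x.2

/-- `β̂` is extremal in direction `v` with respect to `B`. -/
def ExtremalIn {Q L M : Type*} {k : ℕ} [Fintype Q] [Fintype L] [Fintype M] [DecidableEq Q]
    (D : PreMDP Q L M) (B : Matrix Q (Fin k) ℝ) (βh : Q → M → ℝ) (v : L × Fin k → ℝ) : Prop :=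
  ∀ q : Q, ∀ β, IsLocal D β →
    point D B (Pi.single q 1) β ⬝ᵥ v ≤ point D B (Pi.single q 1) βh ⬝ᵥ v ∧
    (point D B (Pi.single q 1) β ⬝ᵥ v = point D B (Pi.single q 1) βh ⬝ᵥ v →
      point D B (Pi.single q 1) β = point D B (Pi.single q 1) βh)

/-- `β̂` is extremal with respect to `B`: extremal in some direction. -/
def Extremal {Q L M : Type*} {k : ℕ} [Fintype Q] [Fintype L] [Fintype M] [DecidableEq Q]
    (D : PreMDP Q L M) (B : Matrix Q (Fin k) ℝ) (βh : Q → M → ℝ) : Prop :=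
  ∃ v, ExtremalIn D B βh v

/-- The polytope `P_μ = { p(μ, β) : β a local strategy }`. -/
def Pset {Q L M : Type*} {k : ℕ} [Fintype Q] (D : PreMDP Q L M) (B : Matrix Q (Fin k) ℝ)
    (μ : Q → ℝ) : Set (L × Fin k → ℝ) :=
  { x | ∃ β, IsLocal D β ∧ x = point D B μ β }

/-- Column space of a matrix. -/
def colSpace {Q : Type*} {k : ℕ} (B : Matrix Q (Fin k) ℝ) : Submodule ℝ (Q → ℝ) :=
  Submodule.span ℝ (Set.range fun j => fun q => B q j)

/-- The vector of label-wise `B`-weighted outcomes of a single move. -/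
noncomputable def moveVec {Q L M : Type*} {k : ℕ} [Fintype Q] (D : PreMDP Q L M)
    (B : Matrix Q (Fin k) ℝ) (m : M) : L × Fin k → ℝ :=
  fun x => ∑ q, D.prob m x.1 q * B q x.2

lemma point_eq_sum_smul_moveVec {Q L M : Type*} {k : ℕ} [Fintype Q] (D : PreMDP Q L M)
    (B : Matrix Q (Fin k) ℝ) (μ : Q → ℝ) (β : Q → M → ℝ) :
    point D B μ β = ∑ q, μ q • ∑ m ∈ D.moves q, β q m • moveVec D B m := by
  funext x
  simp only [point, moveVec, Matrix.vecMul, dotProduct, transMat, Matrix.of_apply,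
    Finset.sum_apply, Pi.smul_apply, smul_eq_mul, Finset.sum_mul, Finset.mul_sum]
  rw [Finset.sum_comm]
  refine Finset.sum_congr rfl fun q _ => ?_
  rw [Finset.sum_comm]
  simp only [mul_assoc]

lemma point_single {Q L M : Type*} {k : ℕ} [Fintype Q] [DecidableEq Q] (D : PreMDP Q L M)
    (B : Matrix Q (Fin k) ℝ) (q : Q) (β : Q → M → ℝ) :
    point D B (Pi.single q 1) β = ∑ m ∈ D.moves q, β q m • moveVec D B m := by
  rw [point_eq_sum_smul_moveVec, Finset.sum_eq_single q]
  · simp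
  · intro q' _ h
    simp [h]
  · simp

lemma point_eq_sum_smul_point_single {Q L M : Type*} {k : ℕ} [Fintype Q] [DecidableEq Q]
    (D : PreMDP Q L M) (B : Matrix Q (Fin k) ℝ) (μ : Q → ℝ) (β : Q → M → ℝ) :
    point D B μ β = ∑ q, μ q • point D B (Pi.single q 1) β := by
  simp only [point_single]
  exact point_eq_sum_smul_moveVec D B μ β

lemma point_eq_iff {Q L M : Type*} {k : ℕ} [Fintype Q] (D : PreMDP Q L M)
    (B : Matrix Q (Fin k) ℝ) (μ ν : Q → ℝ) (β γ : Q → M → ℝ) :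
    point D B μ β = point D B ν γ ↔
      ∀ a, Matrix.vecMul (Succ D μ β a) B = Matrix.vecMul (Succ D ν γ a) B :=
  ⟨fun h a => funext fun j => congrFun h (a, j), fun h => funext fun x => congrFun (h x.1) x.2⟩

lemma IsSubDist.succ {Q L M : Type*} [Fintype Q] [Fintype L] {D : PreMDP Q L M} (hD : IsMDP D)
    {μ : Q → ℝ} (hμ : IsSubDist μ) {β : Q → M → ℝ} (hβ : IsLocal D β) (a : L) :
    IsSubDist (Succ D μ β a) := by
  obtain ⟨-, -, -, hprob, hsum⟩ := hD
  have hle : ∀ q, ∀ m ∈ D.moves q, ∑ q', D.prob m a q' ≤ 1 := fun q m hm => by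
    rw [← hsum q m hm]
    exact Finset.single_le_sum (f := fun a => ∑ q', D.prob m a q')
      (fun a _ => Finset.sum_nonneg fun q' _ => hprob m a q') (Finset.mem_univ a)
  constructor
  · intro q'
    exact Finset.sum_nonneg fun q _ => mul_nonneg (hμ.1 q)
      (Finset.sum_nonneg fun m _ => mul_nonneg ((hβ q).1 m) (hprob m a q'))
  · calc ∑ q', Succ D μ β a q'
        = ∑ q, μ q * ∑ m ∈ D.moves q, β q m * ∑ q', D.prob m a q' := by
          simp only [Succ, Matrix.vecMul, dotProduct, transMat, Matrix.of_apply]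
          rw [Finset.sum_comm]
          refine Finset.sum_congr rfl fun q _ => ?_
          rw [← Finset.mul_sum, Finset.sum_comm]
          simp only [Finset.mul_sum]
      _ ≤ ∑ q, μ q * 1 := by
          refine Finset.sum_le_sum fun q _ => mul_le_mul_of_nonneg_left ?_ (hμ.1 q)
          rw [← (hβ q).2.2]
          exact Finset.sum_le_sum fun m hm =>
            mul_le_of_le_one_right ((hβ q).1 m) (hle q m hm)
      _ ≤ 1 := by simpa using hμ.2

lemma simN_of_simN_succ {Q L M : Type*} [Fintype Q] (D : PreMDP Q L M) (n : ℕ) :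
    ∀ μ ν : Q → ℝ, simN D (n + 1) μ ν → simN D n μ ν := by
  induction n with
  | zero => exact fun μ ν h => h.1
  | succ n ih =>
    rintro μ ν ⟨h0, h1, h2⟩
    refine ⟨h0, fun β hβ => ?_, fun γ hγ => ?_⟩
    · obtain ⟨γ, hγ, h⟩ := h1 β hβ
      exact ⟨γ, hγ, fun a => ih _ _ (h a)⟩
    · obtain ⟨β, hβ, h⟩ := h2 γ hγ
      exact ⟨β, hβ, fun a => ih _ _ (h a)⟩

lemma sum_eq_of_simN {Q L M : Type*} [Fintype Q] {D : PreMDP Q L M} {n : ℕ} {μ ν : Q → ℝ}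
    (h : simN D n μ ν) : ∑ q, μ q = ∑ q, ν q := by
  cases n with
  | zero => exact h
  | succ n => exact h.1

/-- The relation `∼ₙ₊₁` in terms of points, when `B` characterizes `∼ₙ`. -/
lemma simN_succ_iff_point {Q L M : Type*} {k : ℕ} [Fintype Q] [Fintype L]
    {D : PreMDP Q L M} (hD : IsMDP D) {n : ℕ} {B : Matrix Q (Fin k) ℝ}
    (hB : ∀ μ ν : Q → ℝ, IsSubDist μ → IsSubDist ν →
      (simN D n μ ν ↔ Matrix.vecMul μ B = Matrix.vecMul ν B))
    {μ ν : Q → ℝ} (hμ : IsSubDist μ) (hν : IsSubDist ν) :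
    simN D (n + 1) μ ν ↔ (∑ q, μ q = ∑ q, ν q) ∧
      (∀ β, IsLocal D β → ∃ γ, IsLocal D γ ∧ point D B μ β = point D B ν γ) ∧
      (∀ γ, IsLocal D γ → ∃ β, IsLocal D β ∧ point D B μ β = point D B ν γ) := by
  have key : ∀ β γ, IsLocal D β → IsLocal D γ →
      ((∀ a, simN D n (Succ D μ β a) (Succ D ν γ a)) ↔ point D B μ β = point D B ν γ) :=
    fun β γ hβ hγ => by
      rw [point_eq_iff]
      exact forall_congr' fun a => hB _ _ (hμ.succ hD hβ a) (hν.succ hD hγ a)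
  refine and_congr Iff.rfl (and_congr ?_ ?_)
  · exact forall₂_congr fun β hβ => exists_congr fun γ =>
      and_congr_right fun hγ => key β γ hβ hγ
  · exact forall₂_congr fun γ hγ => exists_congr fun β =>
      and_congr_right fun hβ => key β γ hβ hγ

lemma point_dotProduct {Q L M : Type*} {k : ℕ} [Fintype Q] [DecidableEq Q] [Fintype L]
    (D : PreMDP Q L M) (B : Matrix Q (Fin k) ℝ) (μ : Q → ℝ) (β : Q → M → ℝ)
    (v : L × Fin k → ℝ) :
    point D B μ β ⬝ᵥ v = ∑ q, μ q * (point D B (Pi.single q 1) β ⬝ᵥ v) := by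
  rw [point_eq_sum_smul_point_single, sum_dotProduct]
  simp only [smul_dotProduct, smul_eq_mul]

lemma ExtremalIn.point_le {Q L M : Type*} {k : ℕ} [Fintype Q] [Fintype L] [Fintype M]
    [DecidableEq Q] {D : PreMDP Q L M} {B : Matrix Q (Fin k) ℝ} {βh : Q → M → ℝ}
    {v : L × Fin k → ℝ} (h : ExtremalIn D B βh v) {μ : Q → ℝ} (hμ : ∀ q, 0 ≤ μ q)
    {β : Q → M → ℝ} (hβ : IsLocal D β) :
    point D B μ β ⬝ᵥ v ≤ point D B μ βh ⬝ᵥ v := by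
  rw [point_dotProduct, point_dotProduct D B μ βh]
  exact Finset.sum_le_sum fun q _ => mul_le_mul_of_nonneg_left (h q β hβ).1 (hμ q)

lemma ExtremalIn.point_eq {Q L M : Type*} {k : ℕ} [Fintype Q] [Fintype L] [Fintype M]
    [DecidableEq Q] {D : PreMDP Q L M} {B : Matrix Q (Fin k) ℝ} {βh : Q → M → ℝ}
    {v : L × Fin k → ℝ} (h : ExtremalIn D B βh v) {μ : Q → ℝ} (hμ : ∀ q, 0 ≤ μ q)
    {β : Q → M → ℝ} (hβ : IsLocal D β)
    (heq : point D B μ β ⬝ᵥ v = point D B μ βh ⬝ᵥ v) :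
    point D B μ β = point D B μ βh := by
  rw [point_dotProduct, point_dotProduct D B μ βh, Finset.sum_eq_sum_iff_of_le
    fun q _ => mul_le_mul_of_nonneg_left (h q β hβ).1 (hμ q)] at heq
  rw [point_eq_sum_smul_point_single, point_eq_sum_smul_point_single D B μ βh]
  refine Finset.sum_congr rfl fun q hq => ?_
  rcases eq_or_ne (μ q) 0 with h0 | h0
  · simp [h0]
  · rw [(h q β hβ).2 (mul_left_cancel₀ h0 (heq q hq))]

/-- The pure local strategy playing the move `f q` in state `q`. -/
noncomputable def pureStrategy {Q M : Type*} (f : Q → M) : Q → M → ℝ :=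
  open Classical in fun q => Pi.single (f q) 1

lemma isLocal_pureStrategy {Q L M : Type*} {D : PreMDP Q L M} {f : Q → M}
    (hf : ∀ q, f q ∈ D.moves q) : IsLocal D (pureStrategy f) := by
  classical
  refine fun q => ⟨fun m => ?_, fun m hm => ?_, ?_⟩
  · simp only [pureStrategy, Pi.single_apply]
    split_ifs <;> norm_num
  · have : m ≠ f q := fun h => hm (h ▸ hf q)
    simp [pureStrategy, this]
  · simp [pureStrategy, Pi.single_apply, hf q]

lemma point_single_pureStrategy {Q L M : Type*} {k : ℕ} [Fintype Q] [DecidableEq Q]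
    {D : PreMDP Q L M} (B : Matrix Q (Fin k) ℝ) {f : Q → M} (hf : ∀ q, f q ∈ D.moves q) (q : Q) :
    point D B (Pi.single q 1) (pureStrategy f) = moveVec D B (f q) := by
  classical
  rw [point_single, Finset.sum_eq_single (f q)]
  · simp [pureStrategy]
  · intro m _ hm
    simp [pureStrategy, hm]
  · exact fun h => absurd (hf q) h

lemma point_single_dotProduct {Q L M : Type*} {k : ℕ} [Fintype Q] [DecidableEq Q] [Fintype L]
    (D : PreMDP Q L M) (B : Matrix Q (Fin k) ℝ) (q : Q) (β : Q → M → ℝ) (v : L × Fin k → ℝ) :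
    point D B (Pi.single q 1) β ⬝ᵥ v = ∑ m ∈ D.moves q, β q m * (moveVec D B m ⬝ᵥ v) := by
  rw [point_single, sum_dotProduct]
  simp only [smul_dotProduct, smul_eq_mul]

lemma point_single_dotProduct_le {Q L M : Type*} {k : ℕ} [Fintype Q] [DecidableEq Q] [Fintype L]
    {D : PreMDP Q L M} (B : Matrix Q (Fin k) ℝ) {β : Q → M → ℝ} (hβ : IsLocal D β) (q : Q)
    {v : L × Fin k → ℝ} {c : ℝ} (hc : ∀ m ∈ D.moves q, moveVec D B m ⬝ᵥ v ≤ c) :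
    point D B (Pi.single q 1) β ⬝ᵥ v ≤ c := by
  rw [point_single_dotProduct]
  calc ∑ m ∈ D.moves q, β q m * (moveVec D B m ⬝ᵥ v)
      ≤ ∑ m ∈ D.moves q, β q m * c :=
        Finset.sum_le_sum fun m hm => mul_le_mul_of_nonneg_left (hc m hm) ((hβ q).1 m)
    _ = c := by rw [← Finset.sum_mul, (hβ q).2.2, one_mul]

/-- If `v` separates all distinct move vectors, then any pure strategy of `v`-maximal moves is
extremal in direction `v`. -/
lemma extremalIn_pureStrategy {Q L M : Type*} {k : ℕ} [Fintype Q] [Fintype L] [Fintype M]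
    [DecidableEq Q] {D : PreMDP Q L M} {B : Matrix Q (Fin k) ℝ} {v : L × Fin k → ℝ}
    (hv : ∀ m m', moveVec D B m ⬝ᵥ v = moveVec D B m' ⬝ᵥ v → moveVec D B m = moveVec D B m')
    {f : Q → M} (hf : ∀ q, f q ∈ D.moves q)
    (hmax : ∀ q, ∀ m ∈ D.moves q, moveVec D B m ⬝ᵥ v ≤ moveVec D B (f q) ⬝ᵥ v) :
    ExtremalIn D B (pureStrategy f) v := by
  intro q β hβ
  rw [point_single_pureStrategy B hf]
  refine ⟨point_single_dotProduct_le B hβ q (hmax q), fun heq => ?_⟩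
  have hone : ∑ m ∈ D.moves q, β q m * (moveVec D B (f q) ⬝ᵥ v) = moveVec D B (f q) ⬝ᵥ v := by
    rw [← Finset.sum_mul, (hβ q).2.2, one_mul]
  rw [point_single_dotProduct, ← hone, Finset.sum_eq_sum_iff_of_le
    fun m hm => mul_le_mul_of_nonneg_left (hmax q m hm) ((hβ q).1 m)] at heq
  calc point D B (Pi.single q 1) β = ∑ m ∈ D.moves q, β q m • moveVec D B (f q) := by
        rw [point_single]
        refine Finset.sum_congr rfl fun m hm => ?_
        rcases eq_or_ne (β q m) 0 with h0 | h0
        · simp [h0]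
        · rw [hv m (f q) (mul_left_cancel₀ h0 (heq m hm))]
    _ = moveVec D B (f q) := by rw [← Finset.sum_smul, (hβ q).2.2, one_smul]

/-- Directions that separate the distinct members of a finite family of vectors are dense. -/
lemma dense_setOf_dotProduct_separating {ι M : Type*} [Fintype ι] [Finite M] (P : M → ι → ℝ) :
    Dense {v : ι → ℝ | ∀ m m', P m ⬝ᵥ v = P m' ⬝ᵥ v → P m = P m'} := by
  have hset : {v : ι → ℝ | ∀ m m', P m ⬝ᵥ v = P m' ⬝ᵥ v → P m = P m'} =
      ⋂ x : {x : M × M // P x.1 ≠ P x.2},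
        ((LinearMap.ker (dotProductBilin ℝ ℝ (P x.1.1 - P x.1.2)) : Set (ι → ℝ))ᶜ) := by
    ext v
    simp only [Set.mem_ofPred_eq, Set.mem_iInter, Set.mem_compl_iff, SetLike.mem_coe,
      LinearMap.mem_ker, dotProductBilin_apply_apply, sub_dotProduct, sub_eq_zero, Subtype.forall,
      Prod.forall]
    exact forall₂_congr fun m m' => not_imp_not.symm
  rw [hset]
  refine dense_iInter_of_isOpen
    (fun x => (Submodule.closed_of_finiteDimensional _).isOpen_compl) fun x => ?_
  refine interior_eq_empty_iff_dense_compl.mp (Set.not_nonempty_iff_eq_empty.mp fun hint => x.2 ?_)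
  have htop := Submodule.eq_top_of_nonempty_interior' _ hint
  have hmem := (Submodule.eq_top_iff'.mp htop) (P x.1.1 - P x.1.2)
  simp only [LinearMap.mem_ker, dotProductBilin_apply_apply, dotProduct_self_eq_zero] at hmem
  exact sub_eq_zero.mp hmem

lemma isCompact_setOf_isLocal {Q L M : Type*} [Finite Q] [Finite M] (D : PreMDP Q L M) :
    IsCompact {β | IsLocal D β} := by
  refine (isCompact_Icc (a := (0 : Q → M → ℝ)) (b := 1)).of_isClosed_subset ?_ ?_
  · simp only [IsLocal, Set.ofPred_forall, Set.ofPred_and]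
    refine isClosed_iInter fun q => IsClosed.inter ?_ (IsClosed.inter ?_ ?_)
    · exact isClosed_iInter fun m => isClosed_le (by fun_prop) (by fun_prop)
    · exact isClosed_iInter fun m => isClosed_iInter fun _ =>
        isClosed_eq (by fun_prop) (by fun_prop)
    · exact isClosed_eq (by fun_prop) (by fun_prop)
  · intro β hβ
    refine ⟨fun q m => (hβ q).1 m, fun q m => ?_⟩
    by_cases hm : m ∈ D.moves q
    · rw [Pi.one_apply, Pi.one_apply, ← (hβ q).2.2]
      exact Finset.single_le_sum (fun m _ => (hβ q).1 m) hm
    · rw [(hβ q).2.1 m hm]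
      exact zero_le_one

lemma isCompact_Pset {Q L M : Type*} {k : ℕ} [Fintype Q] [Finite M] (D : PreMDP Q L M)
    (B : Matrix Q (Fin k) ℝ) (μ : Q → ℝ) : IsCompact (Pset D B μ) := by
  have himage : Pset D B μ = point D B μ '' {β | IsLocal D β} := by
    ext x
    exact exists_congr fun β => and_congr_right fun _ => eq_comm
  rw [himage]
  refine (isCompact_setOf_isLocal D).image ?_
  simp only [funext (point_eq_sum_smul_moveVec D B μ)]
  fun_prop

lemma convex_Pset {Q L M : Type*} {k : ℕ} [Fintype Q] (D : PreMDP Q L M)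
    (B : Matrix Q (Fin k) ℝ) (μ : Q → ℝ) : Convex ℝ (Pset D B μ) := by
  rintro _ ⟨β, hβ, rfl⟩ _ ⟨γ, hγ, rfl⟩ s t hs ht hst
  refine ⟨s • β + t • γ, fun q => ⟨fun m => ?_, fun m hm => ?_, ?_⟩, ?_⟩
  · exact add_nonneg (mul_nonneg hs ((hβ q).1 m)) (mul_nonneg ht ((hγ q).1 m))
  · simp [(hβ q).2.1 m hm, (hγ q).2.1 m hm]
  · simp [Finset.sum_add_distrib, ← Finset.mul_sum, (hβ q).2.2, (hγ q).2.2, hst]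
  · simp only [point_eq_sum_smul_moveVec, Pi.add_apply, Pi.smul_apply, add_smul,
      Finset.sum_add_distrib, smul_add, Finset.smul_sum, smul_smul, smul_eq_mul, mul_left_comm]

/-- The support function of `Pset D B μ`. -/
noncomputable def supportFun {Q L M : Type*} {k : ℕ} [Fintype Q] [Fintype L] {D : PreMDP Q L M}
    (hne : ∀ q, (D.moves q).Nonempty) (B : Matrix Q (Fin k) ℝ) (μ : Q → ℝ)
    (v : L × Fin k → ℝ) : ℝ :=
  ∑ q, μ q * (D.moves q).sup' (hne q) fun m => moveVec D B m ⬝ᵥ v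

lemma continuous_supportFun {Q L M : Type*} {k : ℕ} [Fintype Q] [Fintype L] {D : PreMDP Q L M}
    (hne : ∀ q, (D.moves q).Nonempty) (B : Matrix Q (Fin k) ℝ) (μ : Q → ℝ) :
    Continuous (supportFun hne B μ) := by
  refine continuous_finsetSum _ fun q _ => continuous_const.mul ?_
  refine Continuous.finset_sup'_apply (hne q) fun m _ => ?_
  exact continuous_const.dotProduct continuous_id

lemma point_dotProduct_le_supportFun {Q L M : Type*} {k : ℕ} [Fintype Q] [Fintype L]
    {D : PreMDP Q L M} (hne : ∀ q, (D.moves q).Nonempty) (B : Matrix Q (Fin k) ℝ) {μ : Q → ℝ}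
    (hμ : ∀ q, 0 ≤ μ q) {β : Q → M → ℝ} (hβ : IsLocal D β) (v : L × Fin k → ℝ) :
    point D B μ β ⬝ᵥ v ≤ supportFun hne B μ v := by
  classical
  rw [point_dotProduct]
  exact Finset.sum_le_sum fun q _ => mul_le_mul_of_nonneg_left (point_single_dotProduct_le B hβ q
    fun m hm => Finset.le_sup' (fun m => moveVec D B m ⬝ᵥ v) hm) (hμ q)

/-- For every direction, some pure strategy of maximal moves attains all support functions. -/
lemma exists_pureStrategy_supportFun_eq {Q L M : Type*} {k : ℕ} [Fintype Q] [Fintype L]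
    {D : PreMDP Q L M} (hne : ∀ q, (D.moves q).Nonempty) (B : Matrix Q (Fin k) ℝ)
    (v : L × Fin k → ℝ) :
    ∃ f : Q → M, (∀ q, f q ∈ D.moves q) ∧
      (∀ q, ∀ m ∈ D.moves q, moveVec D B m ⬝ᵥ v ≤ moveVec D B (f q) ⬝ᵥ v) ∧
      ∀ μ, point D B μ (pureStrategy f) ⬝ᵥ v = supportFun hne B μ v := by
  classical
  choose f hf hsup using fun q => Finset.exists_mem_eq_sup' (hne q) fun m => moveVec D B m ⬝ᵥ v
  refine ⟨f, hf, fun q m hm => ?_, fun μ => ?_⟩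
  · rw [← hsup q]
    exact Finset.le_sup' (fun m => moveVec D B m ⬝ᵥ v) hm
  · rw [point_dotProduct]
    exact Finset.sum_congr rfl fun q _ => by rw [point_single_pureStrategy B hf, ← hsup q]

/-- Agreement at all extremal strategies forces equality of the support functions. -/
lemma supportFun_eq_of_extremal {Q L M : Type*} {k : ℕ} [Fintype Q] [Fintype L] [Fintype M]
    [DecidableEq Q] {D : PreMDP Q L M} (hne : ∀ q, (D.moves q).Nonempty)
    {B : Matrix Q (Fin k) ℝ} {μ ν : Q → ℝ}
    (h : ∀ βh, IsLocal D βh → Extremal D B βh → point D B μ βh = point D B ν βh) :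
    supportFun hne B μ = supportFun hne B ν := by
  refine Continuous.ext_on (dense_setOf_dotProduct_separating (moveVec D B))
    (continuous_supportFun hne B μ) (continuous_supportFun hne B ν) fun v hv => ?_
  obtain ⟨f, hf, hmax, hsup⟩ := exists_pureStrategy_supportFun_eq hne B v
  rw [← hsup μ, ← hsup ν,
    h _ (isLocal_pureStrategy hf) ⟨v, extremalIn_pureStrategy hv hf hmax⟩]

lemma Pset_subset_of_supportFun_le {Q L M : Type*} {k : ℕ} [Fintype Q] [Fintype L] [Finite M]
    {D : PreMDP Q L M} (hne : ∀ q, (D.moves q).Nonempty) {B : Matrix Q (Fin k) ℝ} {μ ν : Q → ℝ}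
    (hμ : ∀ q, 0 ≤ μ q) (h : supportFun hne B μ ≤ supportFun hne B ν) :
    Pset D B μ ⊆ Pset D B ν := by
  classical
  rintro x ⟨β, hβ, rfl⟩
  by_contra hx
  obtain ⟨φ, u, hlt, hu⟩ :=
    geometric_hahn_banach_closed_point (convex_Pset D B ν) (isCompact_Pset D B ν).isClosed hx
  obtain ⟨v, hv⟩ : ∃ v : L × Fin k → ℝ, ∀ y, φ y = y ⬝ᵥ v :=
    ⟨fun i => φ (Pi.single i 1), fun y => by
      conv_lhs => rw [pi_eq_sum_univ' y]
      simp [dotProduct, Pi.single]⟩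
  obtain ⟨f, hf, -, hsup⟩ := exists_pureStrategy_supportFun_eq hne B v
  have hle := point_dotProduct_le_supportFun hne B hμ hβ v
  have hν := hlt _ ⟨_, isLocal_pureStrategy hf, rfl⟩
  rw [hv] at hu hν
  rw [hsup ν] at hν
  linarith [h v]

/-- If `B` characterizes `∼ₙ`, then `∼ₙ₊₁` is characterized by agreement
under `B` and under `Δ_{α̂}(a)·B` for all labels `a` and extremal local strategies `α̂`. -/
theorem stmt11 {Q L M : Type*} {k : ℕ} [Fintype Q] [Fintype L] [Fintype M] [DecidableEq Q]
    (D : PreMDP Q L M) (hD : IsMDP D) (n : ℕ) (hk : 1 ≤ k) (B : Matrix Q (Fin k) ℝ)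
    (hB : ∀ μD μE : Q → ℝ, IsSubDist μD → IsSubDist μE →
      (simN D n μD μE ↔ Matrix.vecMul μD B = Matrix.vecMul μE B)) :
    ∀ μD μE : Q → ℝ, IsSubDist μD → IsSubDist μE →
      (simN D (n + 1) μD μE ↔
        (Matrix.vecMul μD B = Matrix.vecMul μE B ∧
          ∀ (a : L) (βh : Q → M → ℝ), IsLocal D βh → Extremal D B βh →
            Matrix.vecMul (Matrix.vecMul μD (transMat D βh a)) B =
              Matrix.vecMul (Matrix.vecMul μE (transMat D βh a)) B)) := by
  intro μ ν hμ hν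
  have hpt : (∀ (a : L) (βh : Q → M → ℝ), IsLocal D βh → Extremal D B βh →
      Matrix.vecMul (Matrix.vecMul μ (transMat D βh a)) B =
        Matrix.vecMul (Matrix.vecMul ν (transMat D βh a)) B) ↔
      ∀ βh, IsLocal D βh → Extremal D B βh → point D B μ βh = point D B ν βh :=
    ⟨fun h βh hl he => (point_eq_iff D B μ ν βh βh).2 fun a => h a βh hl he,
      fun h a βh hl he => (point_eq_iff D B μ ν βh βh).1 (h βh hl he) a⟩
  rw [hpt]
  constructor
  · intro h
    refine ⟨(hB μ ν hμ hν).1 (simN_of_simN_succ D n μ ν h), ?_⟩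
    rintro βh hl ⟨v, hv⟩
    obtain ⟨-, h1, h2⟩ := (simN_succ_iff_point hD hB hμ hν).1 h
    obtain ⟨γ, hγ, hγeq⟩ := h1 βh hl
    obtain ⟨β, hβ, hβeq⟩ := h2 βh hl
    have hle := hv.point_le hμ.1 hβ
    rw [hβeq, hγeq] at hle
    rw [hγeq]
    exact hv.point_eq hν.1 hγ (le_antisymm (hv.point_le hν.1 hγ) hle)
  · rintro ⟨h0, h⟩
    have hsupp := supportFun_eq_of_extremal hD.2.2.1 h
    refine (simN_succ_iff_point hD hB hμ hν).2
      ⟨sum_eq_of_simN ((hB μ ν hμ hν).2 h0), fun β hβ => ?_, fun γ hγ => ?_⟩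
    · exact Pset_subset_of_supportFun_le hD.2.2.1 hμ.1 hsupp.le ⟨β, hβ, rfl⟩
    · obtain ⟨β, hβ, heq⟩ :=
        Pset_subset_of_supportFun_le hD.2.2.1 hν.1 hsupp.ge ⟨γ, hγ, rfl⟩
      exact ⟨β, hβ, heq.symm⟩
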